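/- arXiv:1412.2563 — 2 statements merged into one kernel-verified Lean document; each statement's English description precedes it below -/
import Mathlib

section
/- Let F be an absolutely continuous distribution function with F(0)=0 whose density f admits a Maclaurin series expansion valid for all x > 0, and set G(x) = F(x)·f(x). If for all x > 0 the integral equation ∫₀ˣ f(3y) f(2(x−y)) dy = f(x) ∫₀ˣ (f(y) − 2G(y)) dy holds, then f^{(k)}(0) = (-1)^k f(0)^{k+1} for every natural number k; consequently f(x) = λ e^{-λx} for x > 0 with λ = f(0) > 0. -/
open MeasureTheory intervalIntegral Filter

/-- A power series converging on `(0, ∞)` whose first `n` coefficients vanish is `x ^ n` times a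
continuous function. -/
lemma exists_continuous_hasSum_eq_pow_mul (b : ℕ → ℝ)
    (hs : ∀ x > (0 : ℝ), Summable fun k => b k * x ^ k) (n : ℕ) (hb : ∀ i < n, b i = 0) :
    ∃ k : ℝ → ℝ, Continuous k ∧ k 0 = b n ∧
      ∀ x s, HasSum (fun i => b i * x ^ i) s → s = x ^ n * k x := by
  have hs' : ∀ R > (0 : ℝ), Summable fun j => |b (j + n)| * R ^ j := by
    intro R hR
    have h := (((summable_nat_add_iff n).2 (hs R hR)).abs).mul_right ((R ^ n)⁻¹)
    refine h.congr fun j => ?_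
    have : R ^ n ≠ 0 := by positivity
    rw [abs_mul, abs_of_nonneg (by positivity : 0 ≤ R ^ (j + n)), pow_add]
    field_simp
  refine ⟨fun x => ∑' j, b (j + n) * x ^ j, ?_, ?_, ?_⟩
  · rw [continuous_iff_continuousAt]
    intro x
    have hR : (0 : ℝ) < |x| + 1 := by positivity
    have hc : ContinuousOn (fun x : ℝ => ∑' j, b (j + n) * x ^ j)
        (Metric.ball 0 (|x| + 1)) := by
      refine continuousOn_tsum (fun j => by fun_prop) (hs' _ hR) ?_
      intro j y hy
      have hy' : |y| ≤ |x| + 1 := by simpa using (mem_ball_zero_iff.1 hy).le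
      rw [Real.norm_eq_abs, abs_mul, abs_pow]
      gcongr
    refine hc.continuousAt (Metric.isOpen_ball.mem_nhds ?_)
    simp
  · show ∑' j, b (j + n) * (0 : ℝ) ^ j = b n
    rw [tsum_eq_single 0]
    · simp
    · intro j hj
      simp [hj]
  · intro x s h
    show s = x ^ n * ∑' j, b (j + n) * x ^ j
    rw [← tsum_mul_left]
    have h2 : HasSum (fun j => b (j + n) * x ^ (j + n)) s := by
      have := (hasSum_nat_add_iff' n).2 h
      rwa [Finset.sum_eq_zero, sub_zero] at this
      intro i hi
      rw [hb i (Finset.mem_range.1 hi), zero_mul]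
    rw [← h2.tsum_eq]
    congr 1
    ext j
    ring

lemma continuous_integral_unitInterval {u : ℝ → ℝ → ℝ} (hu : Continuous (Function.uncurry u)) :
    Continuous fun x => ∫ t in (0 : ℝ)..1, u x t :=
  intervalIntegral.continuous_parametric_intervalIntegral_of_continuous' hu 0 1

lemma integral_eq_mul_integral_unitInterval (u : ℝ → ℝ) (x : ℝ) :
    ∫ y in (0 : ℝ)..x, u y = x * ∫ t in (0 : ℝ)..1, u (x * t) := by
  simp

lemma apply_zero_eq_of_forall_pos_eq {φ ψ : ℝ → ℝ} (hφ : Continuous φ) (hψ : Continuous ψ)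
    (h : ∀ x > (0 : ℝ), φ x = ψ x) : φ 0 = ψ 0 := by
  have h1 : Tendsto φ (nhdsWithin 0 (Set.Ioi 0)) (nhds (φ 0)) := hφ.continuousWithinAt
  have h2 : Tendsto ψ (nhdsWithin 0 (Set.Ioi 0)) (nhds (ψ 0)) := hψ.continuousWithinAt
  refine tendsto_nhds_unique (h1.congr' ?_) h2
  filter_upwards [self_mem_nhdsWithin] with x hx using h x hx

/-- For continuous `g` with primitive `Φ`, the integral of `g - 2 Φ g` is `Φ - Φ ^ 2`. -/
lemma integral_sub_two_mul_primitive {g : ℝ → ℝ} (hg : Continuous g) (x : ℝ) :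
    ∫ y in (0 : ℝ)..x, (g y - 2 * ((∫ t in (0 : ℝ)..y, g t) * g y))
      = (∫ t in (0 : ℝ)..x, g t) - (∫ t in (0 : ℝ)..x, g t) ^ 2 := by
  have hd : ∀ y, HasDerivAt (fun y => ∫ t in (0 : ℝ)..y, g t) (g y) y := fun y =>
    intervalIntegral.integral_hasDerivAt_right (hg.intervalIntegrable _ _)
      (hg.stronglyMeasurableAtFilter _ _) hg.continuousAt
  have hcont : Continuous fun y => ∫ t in (0 : ℝ)..y, g t :=
    continuous_iff_continuousAt.2 fun y => (hd y).continuousAt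
  have hF : ∀ y ∈ Set.uIcc 0 x, HasDerivAt
      (fun y => (∫ t in (0 : ℝ)..y, g t) - (∫ t in (0 : ℝ)..y, g t) ^ 2)
      (g y - 2 * ((∫ t in (0 : ℝ)..y, g t) * g y)) y := by
    intro y _
    refine ((hd y).sub ((hd y).pow 2)).congr_deriv ?_
    norm_num
    ring
  rw [intervalIntegral.integral_eq_sub_of_hasDerivAt hF
    (Continuous.intervalIntegrable (by fun_prop) _ _)]
  simp

/-- The integral equation on `(0, ∞)`, rescaled to the unit interval. -/
lemma rescaled_integral_equation {F f g : ℝ → ℝ} (hg : Continuous g)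
    (hfg : ∀ x ≥ (0 : ℝ), f x = g x)
    (hdens : ∀ x ≥ (0 : ℝ), F x = ∫ t in (0 : ℝ)..x, f t)
    (heq : ∀ x > (0 : ℝ),
      ∫ y in (0 : ℝ)..x, f (3 * y) * f (2 * (x - y))
        = f x * ∫ y in (0 : ℝ)..x, (f y - 2 * (F y * f y)))
    {x : ℝ} (hx : 0 < x) :
    ∫ t in (0 : ℝ)..1, g (3 * (x * t)) * g (2 * (x - x * t))
      = g x * (∫ t in (0 : ℝ)..1, g (x * t)) * (1 - x * ∫ t in (0 : ℝ)..1, g (x * t)) := by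
  have hF : ∀ y ≥ (0 : ℝ), F y = ∫ t in (0 : ℝ)..y, g t := by
    intro y hy
    rw [hdens y hy]
    refine intervalIntegral.integral_congr fun t ht => hfg t ?_
    rw [Set.uIcc_of_le hy] at ht
    exact ht.1
  have h := heq x hx
  have hl : ∫ y in (0 : ℝ)..x, f (3 * y) * f (2 * (x - y))
      = ∫ y in (0 : ℝ)..x, g (3 * y) * g (2 * (x - y)) := by
    refine intervalIntegral.integral_congr fun t ht => ?_
    rw [Set.uIcc_of_le hx.le] at ht
    have h1 := hfg (3 * t) (by linarith [ht.1])
    have h2 := hfg (2 * (x - t)) (by linarith [ht.2])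
    simp only [h1, h2]
  have hr : ∫ y in (0 : ℝ)..x, (f y - 2 * (F y * f y))
      = ∫ y in (0 : ℝ)..x, (g y - 2 * ((∫ t in (0 : ℝ)..y, g t) * g y)) := by
    refine intervalIntegral.integral_congr fun t ht => ?_
    rw [Set.uIcc_of_le hx.le] at ht
    simp only [hfg t ht.1, hF t ht.1]
  rw [hl, hr, integral_sub_two_mul_primitive hg, hfg x hx.le,
    integral_eq_mul_integral_unitInterval _ x, integral_eq_mul_integral_unitInterval g x] at h
  refine mul_left_cancel₀ hx.ne' ?_
  rw [h]
  ring

lemma mul_integral_exponential (l x : ℝ) :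
    x * ∫ t in (0 : ℝ)..1, l * Real.exp (-l * (x * t)) = 1 - Real.exp (-l * x) := by
  rw [← integral_eq_mul_integral_unitInterval (fun y => l * Real.exp (-l * y))]
  have hF : ∀ y ∈ Set.uIcc 0 x, HasDerivAt (fun y => -Real.exp (-l * y))
      (l * Real.exp (-l * y)) y := by
    intro y _
    refine ((hasDerivAt_id' y).const_mul (-l)).exp.neg.congr_deriv ?_
    ring
  rw [intervalIntegral.integral_eq_sub_of_hasDerivAt hF
    (Continuous.intervalIntegrable (by fun_prop) _ _)]
  simp
  ring

lemma rescaled_integral_equation_exponential (l x : ℝ) :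
    ∫ t in (0 : ℝ)..1, (l * Real.exp (-l * (3 * (x * t)))) *
        (l * Real.exp (-l * (2 * (x - x * t))))
      = (l * Real.exp (-l * x)) * (∫ t in (0 : ℝ)..1, l * Real.exp (-l * (x * t))) *
        (1 - x * ∫ t in (0 : ℝ)..1, l * Real.exp (-l * (x * t))) := by
  rw [mul_integral_exponential]
  have : ∀ t, (l * Real.exp (-l * (3 * (x * t)))) * (l * Real.exp (-l * (2 * (x - x * t))))
      = (l * Real.exp (-l * x) * Real.exp (-l * x)) * (l * Real.exp (-l * (x * t))) := by
    intro t
    have : Real.exp (-l * (3 * (x * t))) * Real.exp (-l * (2 * (x - x * t)))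
      = Real.exp (-l * x) * Real.exp (-l * x) * Real.exp (-l * (x * t)) := by
      rw [← Real.exp_add, ← Real.exp_add, ← Real.exp_add]
      congr 1
      ring
    linear_combination l ^ 2 * this
  simp only [this, intervalIntegral.integral_const_mul]
  ring

lemma integral_one_sub_pow (n : ℕ) : ∫ t in (0 : ℝ)..1, (1 - t) ^ n = 1 / ((n : ℝ) + 1) := by
  rw [intervalIntegral.integral_comp_sub_left (fun t => t ^ n)]
  simp

/-- Jensen's inequality for the density `6 t (1 - t)` on the unit interval. -/
lemma one_le_integral_pow (n : ℕ) :
    1 ≤ ∫ t in (0 : ℝ)..1, (3 * t) ^ n * (2 * (1 - t)) ^ n := by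
  have h : ∫ t in (0 : ℝ)..1, (1 + (n : ℝ) * (6 * t - 6 * t ^ 2 - 1)) = 1 := by
    have hF : ∀ y ∈ Set.uIcc (0 : ℝ) 1, HasDerivAt
        (fun t : ℝ => t + (n : ℝ) * (3 * t ^ 2 - 2 * t ^ 3 - t))
        (1 + (n : ℝ) * (6 * y - 6 * y ^ 2 - 1)) y := by
      intro y _
      have hi := hasDerivAt_id' y
      refine (hi.add ((((hi.pow 2).const_mul 3).sub ((hi.pow 3).const_mul 2) |>.sub hi).const_mul
        (n : ℝ))).congr_deriv ?_
      push_cast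
      ring
    rw [intervalIntegral.integral_eq_sub_of_hasDerivAt hF
      (Continuous.intervalIntegrable (by fun_prop) _ _)]
    norm_num
  calc (1 : ℝ) = _ := h.symm
    _ ≤ _ := by
      refine intervalIntegral.integral_mono_on (by norm_num)
        (Continuous.intervalIntegrable (by fun_prop) _ _)
        (Continuous.intervalIntegrable (by fun_prop) _ _) ?_
      intro t ht
      have h0 : 0 ≤ t * (1 - t) := mul_nonneg ht.1 (by linarith [ht.2])
      refine (one_add_mul_le_pow (by nlinarith) n).trans (le_of_eq ?_)
      rw [← mul_pow]
      congr 1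
      ring

/-- A perturbation of order exactly `n ≥ 1` at `0` of the zero function does not solve the rescaled
equation. -/
lemma leading_coeff_eq_zero_of_zero {k : ℝ → ℝ} (hk : Continuous k) {n : ℕ} (hn : n ≠ 0)
    (h : ∀ x > (0 : ℝ),
      ∫ t in (0 : ℝ)..1, ((3 * (x * t)) ^ n * k (3 * (x * t))) *
          ((2 * (x - x * t)) ^ n * k (2 * (x - x * t)))
        = (x ^ n * k x) * (∫ t in (0 : ℝ)..1, (x * t) ^ n * k (x * t)) *
          (1 - x * ∫ t in (0 : ℝ)..1, (x * t) ^ n * k (x * t))) :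
    k 0 = 0 := by
  have h1 : Continuous fun x => ∫ t in (0 : ℝ)..1, ((3 * t) ^ n * (2 * (1 - t)) ^ n) *
      (k (3 * (x * t)) * k (2 * (x - x * t))) :=
    continuous_integral_unitInterval (by unfold Function.uncurry; fun_prop)
  have h2 : Continuous fun x => ∫ t in (0 : ℝ)..1, t ^ n * k (x * t) :=
    continuous_integral_unitInterval (by unfold Function.uncurry; fun_prop)
  have h3 : Continuous fun x => ∫ t in (0 : ℝ)..1, (x * t) ^ n * k (x * t) :=
    continuous_integral_unitInterval (by unfold Function.uncurry; fun_prop)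
  have h4 := apply_zero_eq_of_forall_pos_eq h1
    (ψ := fun x => k x * (∫ t in (0 : ℝ)..1, t ^ n * k (x * t)) *
          (1 - x * ∫ t in (0 : ℝ)..1, (x * t) ^ n * k (x * t))) (by fun_prop) (by
    intro x hx
    have hl : ∫ t in (0 : ℝ)..1, ((3 * (x * t)) ^ n * k (3 * (x * t))) *
          ((2 * (x - x * t)) ^ n * k (2 * (x - x * t)))
        = x ^ (2 * n) * ∫ t in (0 : ℝ)..1, ((3 * t) ^ n * (2 * (1 - t)) ^ n) *
          (k (3 * (x * t)) * k (2 * (x - x * t))) := by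
      rw [← intervalIntegral.integral_const_mul]
      refine intervalIntegral.integral_congr fun t _ => ?_
      have e1 : (3 * (x * t)) ^ n = x ^ n * (3 * t) ^ n := by rw [← mul_pow]; ring
      have e2 : (2 * (x - x * t)) ^ n = x ^ n * (2 * (1 - t)) ^ n := by rw [← mul_pow]; ring
      simp only [e1, e2]
      ring
    have hr : ∫ t in (0 : ℝ)..1, (x * t) ^ n * k (x * t)
        = x ^ n * ∫ t in (0 : ℝ)..1, t ^ n * k (x * t) := by
      rw [← intervalIntegral.integral_const_mul]
      refine intervalIntegral.integral_congr fun t _ => ?_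
      simp only [mul_pow]
      ring
    have h5 := h x hx
    have h6 : x ^ (2 * n) ≠ 0 := by positivity
    refine mul_left_cancel₀ h6 ?_
    rw [← hl, h5]
    conv_lhs => rw [mul_assoc, mul_assoc, mul_comm (∫ t in (0 : ℝ)..1, (x * t) ^ n * k (x * t)) _]
    nth_rewrite 2 [hr]
    ring)
  simp only [zero_mul, mul_zero, sub_zero, intervalIntegral.integral_mul_const, mul_one,
    integral_pow] at h4
  by_contra hk0
  have h7 := one_le_integral_pow n
  have h8 : ∫ t in (0 : ℝ)..1, (3 * t) ^ n * (2 * (1 - t)) ^ n = 1 / ((n : ℝ) + 1) := by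
    have : k 0 * k 0 ≠ 0 := mul_ne_zero hk0 hk0
    refine mul_right_cancel₀ this ?_
    rw [h4]
    simp
    ring
  rw [h8, le_div_iff₀ (by positivity)] at h7
  have : (1 : ℝ) ≤ n := by exact_mod_cast Nat.one_le_iff_ne_zero.2 hn
  linarith

lemma add_two_lt_two_pow_add_three_pow {n : ℕ} (hn : n ≠ 0) :
    (n : ℝ) + 2 < 2 ^ n + 3 ^ n := by
  have h2 : (1 : ℝ) + n * 1 ≤ (1 + 1) ^ n := one_add_mul_le_pow (by norm_num) n
  have h3 : (1 : ℝ) + n * 2 ≤ (1 + 2) ^ n := one_add_mul_le_pow (by norm_num) n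
  have : (1 : ℝ) ≤ n := by exact_mod_cast Nat.one_le_iff_ne_zero.2 hn
  norm_num at h2 h3
  linarith

/-- A perturbation of order exactly `n ≥ 1` at `0` of a solution `e` of the rescaled equation with
`e 0 ≠ 0` is not a solution. -/
lemma leading_coeff_eq_zero_of_ne_zero {e k : ℝ → ℝ} (he : Continuous e) (hk : Continuous k)
    {n : ℕ} (hn : n ≠ 0) (he0 : e 0 ≠ 0)
    (hsol : ∀ x > (0 : ℝ), ∫ t in (0 : ℝ)..1, e (3 * (x * t)) * e (2 * (x - x * t))
      = e x * (∫ t in (0 : ℝ)..1, e (x * t)) * (1 - x * ∫ t in (0 : ℝ)..1, e (x * t)))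
    (h : ∀ x > (0 : ℝ),
      ∫ t in (0 : ℝ)..1, (e (3 * (x * t)) + (3 * (x * t)) ^ n * k (3 * (x * t))) *
          (e (2 * (x - x * t)) + (2 * (x - x * t)) ^ n * k (2 * (x - x * t)))
        = (e x + x ^ n * k x) * (∫ t in (0 : ℝ)..1, (e (x * t) + (x * t) ^ n * k (x * t))) *
          (1 - x * ∫ t in (0 : ℝ)..1, (e (x * t) + (x * t) ^ n * k (x * t)))) :
    k 0 = 0 := by
  have h1 : Continuous fun x => ∫ t in (0 : ℝ)..1,
      (e (3 * (x * t)) * ((2 * (1 - t)) ^ n * k (2 * (x - x * t)))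
        + (3 * t) ^ n * k (3 * (x * t)) * e (2 * (x - x * t))
        + x ^ n * ((3 * t) ^ n * k (3 * (x * t)) * ((2 * (1 - t)) ^ n * k (2 * (x - x * t))))) :=
    continuous_integral_unitInterval (by unfold Function.uncurry; fun_prop)
  have h2 : Continuous fun x => ∫ t in (0 : ℝ)..1, t ^ n * k (x * t) :=
    continuous_integral_unitInterval (by unfold Function.uncurry; fun_prop)
  have h3 : Continuous fun x => ∫ t in (0 : ℝ)..1, e (x * t) :=
    continuous_integral_unitInterval (by unfold Function.uncurry; fun_prop)
  have h4 := apply_zero_eq_of_forall_pos_eq h1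
    (ψ := fun x =>
      k x * ((∫ t in (0 : ℝ)..1, e (x * t)) + x ^ n * ∫ t in (0 : ℝ)..1, t ^ n * k (x * t)) *
        (1 - x * ((∫ t in (0 : ℝ)..1, e (x * t)) + x ^ n * ∫ t in (0 : ℝ)..1, t ^ n * k (x * t)))
      + e x * (∫ t in (0 : ℝ)..1, t ^ n * k (x * t)) *
        (1 - x * (2 * (∫ t in (0 : ℝ)..1, e (x * t))
          + x ^ n * ∫ t in (0 : ℝ)..1, t ^ n * k (x * t)))) (by fun_prop) (by
    intro x hx
    have hr : ∫ t in (0 : ℝ)..1, (e (x * t) + (x * t) ^ n * k (x * t))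
        = (∫ t in (0 : ℝ)..1, e (x * t)) + x ^ n * ∫ t in (0 : ℝ)..1, t ^ n * k (x * t) := by
      rw [← intervalIntegral.integral_const_mul, ← intervalIntegral.integral_add
        (Continuous.intervalIntegrable (by fun_prop) _ _)
        (Continuous.intervalIntegrable (by fun_prop) _ _)]
      refine intervalIntegral.integral_congr fun t _ => ?_
      simp only [mul_pow]
      ring
    have hl : ∫ t in (0 : ℝ)..1, (e (3 * (x * t)) + (3 * (x * t)) ^ n * k (3 * (x * t))) *
          (e (2 * (x - x * t)) + (2 * (x - x * t)) ^ n * k (2 * (x - x * t)))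
        = (∫ t in (0 : ℝ)..1, e (3 * (x * t)) * e (2 * (x - x * t))) +
          x ^ n * ∫ t in (0 : ℝ)..1,
      (e (3 * (x * t)) * ((2 * (1 - t)) ^ n * k (2 * (x - x * t)))
        + (3 * t) ^ n * k (3 * (x * t)) * e (2 * (x - x * t))
        + x ^ n * ((3 * t) ^ n * k (3 * (x * t)) * ((2 * (1 - t)) ^ n * k (2 * (x - x * t))))) := by
      rw [← intervalIntegral.integral_const_mul, ← intervalIntegral.integral_add
        (Continuous.intervalIntegrable (by fun_prop) _ _)
        (Continuous.intervalIntegrable (by fun_prop) _ _)]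
      refine intervalIntegral.integral_congr fun t _ => ?_
      have e1 : (3 * (x * t)) ^ n = x ^ n * (3 * t) ^ n := by rw [← mul_pow]; ring
      have e2 : (2 * (x - x * t)) ^ n = x ^ n * (2 * (1 - t)) ^ n := by rw [← mul_pow]; ring
      simp only [e1, e2]
      ring
    have h5 := h x hx
    rw [hl, hr, hsol x hx] at h5
    have h6 : x ^ n ≠ 0 := by positivity
    refine mul_left_cancel₀ h6 ?_
    linear_combination h5)
  simp only [zero_mul, mul_zero, sub_zero, intervalIntegral.integral_mul_const, mul_one,
    integral_pow, zero_pow hn, add_zero, intervalIntegral.integral_const, smul_eq_mul,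
    one_mul] at h4
  rw [intervalIntegral.integral_add (Continuous.intervalIntegrable (by fun_prop) _ _)
    (Continuous.intervalIntegrable (by fun_prop) _ _)] at h4
  simp only [intervalIntegral.integral_mul_const, intervalIntegral.integral_const_mul, mul_pow,
    integral_pow, integral_one_sub_pow] at h4
  have h9 := add_two_lt_two_pow_add_three_pow hn
  have hn1 : (n : ℝ) + 1 ≠ 0 := by positivity
  have h10 : k 0 * ((2 ^ n + 3 ^ n) - ((n : ℝ) + 2)) = 0 := by
    refine (mul_eq_zero.1 (?_ : e 0 * _ = 0)).resolve_left he0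
    simp only [one_pow, zero_pow (Nat.succ_ne_zero n), sub_zero] at h4
    have h11 := congrArg (· * ((n : ℝ) + 1)) h4
    field_simp at h11
    linear_combination e 0 * h11
  exact (mul_eq_zero.1 h10).resolve_right (by linarith)

lemma hasSum_exponential_density (l x : ℝ) :
    HasSum (fun k : ℕ => ((-1 : ℝ) ^ k * l ^ (k + 1)) / k.factorial * x ^ k)
      (l * Real.exp (-l * x)) := by
  have h := (NormedSpace.expSeries_div_hasSum_exp (-l * x)).mul_left l
  rw [← Real.exp_eq_exp_ℝ] at h
  refine h.congr_fun ?_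
  intro k
  have : (-l * x) ^ k = (-1) ^ k * l ^ k * x ^ k := by
    rw [← mul_pow, ← mul_pow]
    ring
  rw [this]
  ring

/-- Theorem 1 of the paper, analytic form.  Let `F` be an absolutely continuous
distribution function with `F 0 = 0` whose density `f` admits a Maclaurin series
expansion (one-sided derivatives at `0`) valid for all `x > 0`, and let
`G x = F x * f x`.  If for all `x > 0`
`∫₀ˣ f(3y) f(2(x-y)) dy = f(x) ∫₀ˣ (f(y) - 2 G(y)) dy`,
then `f⁽ᵏ⁾(0) = (-1)^k f(0)^(k+1)` for every `k`; consequently `f(0) > 0` and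
`f x = f 0 * exp (-(f 0) x)` for `x > 0`, i.e. `f` is exponential with rate `λ = f 0`. -/
theorem exponential_of_integral_equation_median
    (F f : ℝ → ℝ)
    (hmono : Monotone F)
    (hF0 : F 0 = 0)
    (htop : Tendsto F atTop (nhds 1))
    (hdens : ∀ x ≥ (0 : ℝ), F x = ∫ t in (0 : ℝ)..x, f t)
    (hsmooth : ContDiffOn ℝ (⊤ : ℕ∞) f (Set.Ici 0))
    (hanal : ∀ x > (0 : ℝ),
      HasSum (fun k : ℕ =>
        iteratedDerivWithin k f (Set.Ici 0) 0 * x ^ k / (Nat.factorial k)) (f x))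
    (heq : ∀ x > (0 : ℝ),
      ∫ y in (0 : ℝ)..x, f (3 * y) * f (2 * (x - y))
        = f x * ∫ y in (0 : ℝ)..x, (f y - 2 * (F y * f y))) :
    (∀ k : ℕ, iteratedDerivWithin k f (Set.Ici 0) 0 = (-1 : ℝ) ^ k * (f 0) ^ (k + 1))
    ∧ 0 < f 0 ∧ ∀ x > (0 : ℝ), f x = f 0 * Real.exp (-(f 0) * x) := by
  set a : ℕ → ℝ := fun k => iteratedDerivWithin k f (Set.Ici 0) 0 with ha
  have ha0 : a 0 = f 0 := by simp [ha]
  set b : ℕ → ℝ := fun k => (a k - (-1 : ℝ) ^ k * (f 0) ^ (k + 1)) / k.factorial with hb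
  have hsum : ∀ x ≥ (0 : ℝ),
      HasSum (fun k => b k * x ^ k) (f x - f 0 * Real.exp (-(f 0) * x)) := by
    intro x hx
    have h1 : HasSum (fun k : ℕ => a k * x ^ k / (Nat.factorial k)) (f x) := by
      rcases hx.lt_or_eq with hx | rfl
      · exact hanal x hx
      · convert hasSum_single (f := fun k : ℕ => a k * (0 : ℝ) ^ k / (Nat.factorial k)) 0 ?_
          using 1
        · simp [ha0]
        · intro k hk
          simp [hk]
    refine (h1.sub (hasSum_exponential_density (f 0) x)).congr_fun fun k => ?_
    simp only [hb]
    ring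
  have hzero : ∀ k, b k = 0 := by
    by_contra! hne
    have hlt : ∀ i < Nat.find hne, b i = 0 := fun i hi => not_not.1 (Nat.find_min hne hi)
    have hspec := Nat.find_spec hne
    set n := Nat.find hne
    have hn : n ≠ 0 := by
      intro h0
      rw [h0] at hspec
      simp [hb, ha0] at hspec
    obtain ⟨k, hk, hk0, hkx⟩ := exists_continuous_hasSum_eq_pow_mul b
      (fun x hx => (hsum x hx.le).summable) n hlt
    have hfg : ∀ x ≥ (0 : ℝ), f x = f 0 * Real.exp (-(f 0) * x) + x ^ n * k x := by
      intro x hx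
      rw [← hkx x _ (hsum x hx)]
      ring
    have heq' := fun x (hx : 0 < x) => rescaled_integral_equation
      (g := fun x => f 0 * Real.exp (-(f 0) * x) + x ^ n * k x) (by fun_prop) hfg hdens heq hx
    refine hspec (hk0 ▸ ?_)
    by_cases hf0 : f 0 = 0
    · refine leading_coeff_eq_zero_of_zero hk hn fun x hx => ?_
      simpa only [hf0, zero_mul, zero_add] using heq' x hx
    · exact leading_coeff_eq_zero_of_ne_zero (e := fun x => f 0 * Real.exp (-(f 0) * x))
        (by fun_prop) hk hn (by simpa using hf0)
        (fun x _ => rescaled_integral_equation_exponential (f 0) x) heq'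
  have hf : ∀ x ≥ (0 : ℝ), f x = f 0 * Real.exp (-(f 0) * x) := by
    intro x hx
    have h := hsum x hx
    simp only [hzero, zero_mul] at h
    linarith [h.unique hasSum_zero]
  have hF : ∀ x ≥ (0 : ℝ), F x = 1 - Real.exp (-(f 0) * x) := by
    intro x hx
    rw [hdens x hx, ← mul_integral_exponential,
      ← integral_eq_mul_integral_unitInterval (fun y => f 0 * Real.exp (-(f 0) * y))]
    refine intervalIntegral.integral_congr fun t ht => hf t ?_
    rw [Set.uIcc_of_le hx] at ht
    exact ht.1
  refine ⟨fun k => ?_, ?_, fun x hx => hf x hx.le⟩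
  · have h := hzero k
    have hfac : (k.factorial : ℝ) ≠ 0 := by positivity
    simp only [hb, div_eq_zero_iff, hfac, or_false] at h
    exact sub_eq_zero.1 h
  · have hnonneg : 0 ≤ f 0 := by
      have h := hmono (zero_le_one' ℝ)
      rw [hF0, hF 1 zero_le_one, sub_nonneg, Real.exp_le_one_iff] at h
      linarith
    refine hnonneg.lt_of_ne fun h0 => ?_
    have h1 : Tendsto F atTop (nhds 0) := by
      refine tendsto_const_nhds.congr' ?_
      filter_upwards [eventually_ge_atTop 0] with x hx
      simp [hF x hx, ← h0]
    exact zero_ne_one (tendsto_nhds_unique h1 htop)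
end

section
/- Let F be an absolutely continuous distribution function with F(0)=0 whose density f admits a Maclaurin series expansion valid for all x > 0; set G(x) = F(x)·f(x) and H(x) = F(x)²·f(x). If for all x > 0 the integral equation ∫₀ˣ f(y) G(x−y) dy − ∫₀ˣ f(y) H(x−y) dy = f(x) ∫₀ˣ G(y) dy holds, then f^{(k)}(0) = (-1)^k f(0)^{k+1} for every natural number k; consequently f(x) = λ e^{-λx} for x > 0 with λ = f(0) > 0. -/
open MeasureTheory intervalIntegral Filter

/-- `u x = a * x ^ p + O(x ^ (p + 1))` uniformly on `[0, 1]`. -/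
def HasLeadingTerm (u : ℝ → ℝ) (p : ℕ) (a : ℝ) : Prop :=
  ∃ C, 0 ≤ C ∧ ∀ x, 0 ≤ x → x ≤ 1 → |u x - a * x ^ p| ≤ C * x ^ (p + 1)

/-- The Beta integral with natural exponents. -/
noncomputable def betaNat (p q : ℕ) : ℝ := ∫ t in (0 : ℝ)..1, t ^ p * (1 - t) ^ q

theorem integral_pow_mul_sub_pow (p q : ℕ) (x : ℝ) :
    ∫ y in (0 : ℝ)..x, y ^ p * (x - y) ^ q = betaNat p q * x ^ (p + q + 1) := by
  have h := intervalIntegral.mul_integral_comp_mul_left (a := (0 : ℝ)) (b := 1)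
    (f := fun y => y ^ p * (x - y) ^ q) x
  simp only [mul_zero, mul_one] at h
  rw [← h, betaNat, mul_comm (∫ t in (0 : ℝ)..1, _), ← intervalIntegral.integral_const_mul,
    ← intervalIntegral.integral_const_mul]
  congr 1
  ext t
  rw [show x - x * t = x * (1 - t) by ring, mul_pow, mul_pow]
  ring

theorem betaNat_zero_right (p : ℕ) : betaNat p 0 = 1 / (p + 1) := by
  simp [betaNat]

theorem betaNat_zero_left (q : ℕ) : betaNat 0 q = 1 / (q + 1) := by
  have h := intervalIntegral.integral_comp_sub_left (a := (0 : ℝ)) (b := 1)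
    (fun y : ℝ => y ^ q) 1
  simp only [betaNat, pow_zero, one_mul, h]
  simp

theorem betaNat_one_right (p : ℕ) : betaNat p 1 = 1 / ((p + 1) * (p + 2)) := by
  have h : ∀ t : ℝ, t ^ p * (1 - t) ^ 1 = t ^ p - t ^ (p + 1) := fun t => by ring
  simp only [betaNat, h]
  rw [intervalIntegral.integral_sub (Continuous.intervalIntegrable (by fun_prop) _ _)
    (Continuous.intervalIntegrable (by fun_prop) _ _), integral_pow, integral_pow]
  have h1 : (p : ℝ) + 1 ≠ 0 := by positivity
  have h2 : (p : ℝ) + 2 ≠ 0 := by positivity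
  have h3 : (p : ℝ) + 1 + 1 ≠ 0 := by positivity
  simp
  field_simp
  ring

theorem betaNat_anti_right (p : ℕ) {q r : ℕ} (hqr : q ≤ r) : betaNat p r ≤ betaNat p q := by
  apply intervalIntegral.integral_mono_on zero_le_one
    (Continuous.intervalIntegrable (by fun_prop) _ _)
    (Continuous.intervalIntegrable (by fun_prop) _ _)
  intro t ht
  exact mul_le_mul_of_nonneg_left
    (pow_le_pow_of_le_one (by linarith [ht.2]) (by linarith [ht.1]) hqr) (pow_nonneg ht.1 p)

namespace HasLeadingTerm

variable {u v : ℝ → ℝ} {p q : ℕ} {a b : ℝ}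

theorem congr (hu : HasLeadingTerm u p a) (h : ∀ x, 0 ≤ x → u x = v x) :
    HasLeadingTerm v p a := by
  obtain ⟨C, hC, hu⟩ := hu
  exact ⟨C, hC, fun x h0 h1 => by rw [← h x h0]; exact hu x h0 h1⟩

theorem add (hu : HasLeadingTerm u p a) (hv : HasLeadingTerm v p b) :
    HasLeadingTerm (fun x => u x + v x) p (a + b) := by
  obtain ⟨C, hC, hu⟩ := hu
  obtain ⟨D, hD, hv⟩ := hv
  refine ⟨C + D, by positivity, fun x h0 h1 => ?_⟩
  rw [show u x + v x - (a + b) * x ^ p = (u x - a * x ^ p) + (v x - b * x ^ p) by ring, add_mul]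
  exact (abs_add_le _ _).trans (add_le_add (hu x h0 h1) (hv x h0 h1))

theorem sub (hu : HasLeadingTerm u p a) (hv : HasLeadingTerm v p b) :
    HasLeadingTerm (fun x => u x - v x) p (a - b) := by
  obtain ⟨C, hC, hu⟩ := hu
  obtain ⟨D, hD, hv⟩ := hv
  refine ⟨C + D, by positivity, fun x h0 h1 => ?_⟩
  rw [show u x - v x - (a - b) * x ^ p = (u x - a * x ^ p) - (v x - b * x ^ p) by ring, add_mul]
  exact (abs_sub _ _).trans (add_le_add (hu x h0 h1) (hv x h0 h1))

theorem exists_abs_le (hu : HasLeadingTerm u p a) :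
    ∃ C, 0 ≤ C ∧ ∀ x, 0 ≤ x → x ≤ 1 → |u x| ≤ C * x ^ p := by
  obtain ⟨C, hC, hu⟩ := hu
  refine ⟨C + |a|, by positivity, fun x h0 h1 => ?_⟩
  have h2 : C * x ^ (p + 1) ≤ C * x ^ p :=
    mul_le_mul_of_nonneg_left (pow_le_pow_of_le_one h0 h1 p.le_succ) hC
  have h3 : |a * x ^ p| = |a| * x ^ p := by rw [abs_mul, abs_of_nonneg (pow_nonneg h0 p)]
  calc |u x| = |(u x - a * x ^ p) + a * x ^ p| := by rw [sub_add_cancel]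
    _ ≤ |u x - a * x ^ p| + |a * x ^ p| := abs_add_le _ _
    _ ≤ (C + |a|) * x ^ p := by rw [h3, add_mul]; linarith [hu x h0 h1]

theorem of_lt (hu : HasLeadingTerm u q a) (hpq : p < q) : HasLeadingTerm u p 0 := by
  obtain ⟨C, hC, hu⟩ := hu.exists_abs_le
  refine ⟨C, hC, fun x h0 h1 => ?_⟩
  rw [zero_mul, sub_zero]
  exact (hu x h0 h1).trans (mul_le_mul_of_nonneg_left (pow_le_pow_of_le_one h0 h1 hpq) hC)

/-- A pointwise estimate for products which serves both for products and for convolutions. -/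
theorem exists_abs_mul_sub_le (hu : HasLeadingTerm u p a) (hv : HasLeadingTerm v q b) :
    ∃ C, 0 ≤ C ∧ ∀ x y z, 0 ≤ y → y ≤ x → 0 ≤ z → z ≤ x → x ≤ 1 →
      |u y * v z - a * b * (y ^ p * z ^ q)| ≤ C * x ^ (p + q + 1) := by
  obtain ⟨D, hD, hv'⟩ := hv.exists_abs_le
  obtain ⟨C, hC, hu⟩ := hu
  obtain ⟨E, hE, hv⟩ := hv
  refine ⟨C * D + |a| * E, by positivity, fun x y z hy0 hyx hz0 hzx hx1 => ?_⟩
  have hx0 : 0 ≤ x := hy0.trans hyx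
  have h1 : |(u y - a * y ^ p) * v z| ≤ (C * x ^ (p + 1)) * (D * x ^ q) := by
    rw [abs_mul]
    refine mul_le_mul ((hu y hy0 (hyx.trans hx1)).trans ?_)
      ((hv' z hz0 (hzx.trans hx1)).trans ?_) (abs_nonneg _) (by positivity) <;> gcongr
  have h2 : |a * y ^ p * (v z - b * z ^ q)| ≤ (|a| * x ^ p) * (E * x ^ (q + 1)) := by
    rw [abs_mul, abs_mul, abs_of_nonneg (pow_nonneg hy0 p)]
    refine mul_le_mul ?_ ((hv z hz0 (hzx.trans hx1)).trans ?_) (abs_nonneg _) (by positivity)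
      <;> gcongr
  calc |u y * v z - a * b * (y ^ p * z ^ q)|
      = |(u y - a * y ^ p) * v z + a * y ^ p * (v z - b * z ^ q)| := by congr 1; ring
    _ ≤ (C * x ^ (p + 1)) * (D * x ^ q) + (|a| * x ^ p) * (E * x ^ (q + 1)) :=
        (abs_add_le _ _).trans (add_le_add h1 h2)
    _ = (C * D + |a| * E) * x ^ (p + q + 1) := by ring

theorem mul (hu : HasLeadingTerm u p a) (hv : HasLeadingTerm v q b) :
    HasLeadingTerm (fun x => u x * v x) (p + q) (a * b) := by
  obtain ⟨C, hC, h⟩ := hu.exists_abs_mul_sub_le hv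
  refine ⟨C, hC, fun x h0 h1 => ?_⟩
  rw [pow_add]
  exact h x x x h0 le_rfl h0 le_rfl h1

theorem convolution (hu : HasLeadingTerm u p a) (hv : HasLeadingTerm v q b)
    (hcu : Continuous u) (hcv : Continuous v) :
    HasLeadingTerm (fun x => ∫ y in (0 : ℝ)..x, u y * v (x - y)) (p + q + 1)
      (a * b * betaNat p q) := by
  obtain ⟨C, hC, h⟩ := hu.exists_abs_mul_sub_le hv
  refine ⟨C, hC, fun x h0 h1 => ?_⟩
  dsimp only
  rw [mul_assoc, ← integral_pow_mul_sub_pow, ← intervalIntegral.integral_const_mul,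
    ← intervalIntegral.integral_sub (Continuous.intervalIntegrable (by fun_prop) _ _)
      (Continuous.intervalIntegrable (by fun_prop) _ _)]
  have hb : ∀ y ∈ Set.uIoc 0 x,
      ‖u y * v (x - y) - a * b * (y ^ p * (x - y) ^ q)‖ ≤ C * x ^ (p + q + 1) := by
    intro y hy
    rw [Set.uIoc_of_le h0] at hy
    exact h x y (x - y) hy.1.le hy.2 (by linarith [hy.2]) (by linarith [hy.1]) h1
  refine (intervalIntegral.norm_integral_le_of_norm_le_const hb).trans_eq ?_
  rw [sub_zero, abs_of_nonneg h0, mul_assoc, ← pow_succ]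

theorem const (c : ℝ) : HasLeadingTerm (fun _ => c) 0 c :=
  ⟨0, le_rfl, fun x _ _ => by simp⟩

theorem primitive (hu : HasLeadingTerm u p a) (hcu : Continuous u) :
    HasLeadingTerm (fun x => ∫ y in (0 : ℝ)..x, u y) (p + 1) (a / (p + 1)) := by
  have h := hu.convolution (const 1) hcu continuous_const
  simpa [betaNat_zero_right, div_eq_mul_inv] using h

theorem tendsto (hu : HasLeadingTerm u p a) :
    Tendsto (fun x => u x / x ^ p) (nhdsWithin 0 (Set.Ioi 0)) (nhds a) := by
  obtain ⟨C, hC, hu⟩ := hu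
  rw [tendsto_iff_norm_sub_tendsto_zero]
  have hlim : Tendsto (fun x : ℝ => C * x) (nhdsWithin 0 (Set.Ioi 0)) (nhds 0) := by
    have h : Continuous fun x : ℝ => C * x := by fun_prop
    simpa using (h.tendsto 0).mono_left nhdsWithin_le_nhds
  refine squeeze_zero' (Eventually.of_forall fun _ => norm_nonneg _) ?_ hlim
  filter_upwards [Ioc_mem_nhdsGT (zero_lt_one (α := ℝ))] with x hx
  have hxp : 0 < x ^ p := pow_pos hx.1 p
  rw [show u x / x ^ p - a = (u x - a * x ^ p) / x ^ p by field_simp, norm_div,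
    Real.norm_eq_abs, Real.norm_eq_abs, abs_of_pos hxp, div_le_iff₀ hxp, mul_assoc, ← pow_succ']
  exact hu x hx.1.le hx.2

theorem unique (hu : HasLeadingTerm u p a) (hv : HasLeadingTerm v p b)
    (h : ∀ x, 0 < x → u x = v x) : a = b := by
  refine tendsto_nhds_unique (hu.tendsto.congr' ?_) hv.tendsto
  filter_upwards [self_mem_nhdsWithin] with x hx
  rw [h x hx]

/-- A power series converging on `[0, 1]` has its first nonzero term as leading term. -/
theorem of_hasSum {c : ℕ → ℝ} (hs : ∀ x, 0 ≤ x → HasSum (fun k => c k * x ^ k) (u x))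
    (hc : ∀ k < p, c k = 0) : HasLeadingTerm u p (c p) := by
  have hsum : Summable fun k => |c (k + (p + 1))| := by
    have h1 := (hs 1 zero_le_one).summable
    simp only [one_pow, mul_one] at h1
    exact (summable_nat_add_iff (f := fun k => |c k|) (p + 1)).2 h1.abs
  refine ⟨∑' k, |c (k + (p + 1))|, tsum_nonneg fun _ => abs_nonneg _, fun x h0 h1 => ?_⟩
  have htail := (hasSum_nat_add_iff' (p + 1)).2 (hs x h0)
  rw [Finset.sum_range_succ, Finset.sum_eq_zero (fun k hk => by
    rw [hc k (Finset.mem_range.1 hk), zero_mul]), zero_add] at htail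
  rw [← htail.tsum_eq, ← Real.norm_eq_abs]
  refine tsum_of_norm_bounded (hsum.hasSum.mul_right _) fun k => ?_
  rw [norm_mul, Real.norm_eq_abs, Real.norm_eq_abs, abs_of_nonneg (pow_nonneg h0 _)]
  exact mul_le_mul_of_nonneg_left (pow_le_pow_of_le_one h0 h1 (by omega)) (abs_nonneg _)

end HasLeadingTerm

/-- The analytic equation expressing that the convolution of `f` with the density of the median
equals the density of the maximum, up to the common factor `6`. -/
def MedianMaxEquation (F f : ℝ → ℝ) (x : ℝ) : Prop :=
  ∫ y in (0 : ℝ)..x, f y * (F (x - y) * f (x - y) - F (x - y) ^ 2 * f (x - y))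
    = f x * ∫ y in (0 : ℝ)..x, F y * f y

theorem integral_exp_density (l x : ℝ) :
    ∫ t in (0 : ℝ)..x, l * Real.exp (-l * t) = 1 - Real.exp (-l * x) := by
  have hd : ∀ t ∈ Set.uIcc 0 x,
      HasDerivAt (fun t => -Real.exp (-l * t)) (l * Real.exp (-l * t)) t := fun t _ => by
    have h := ((hasDerivAt_id t).const_mul (-l)).exp.neg
    refine h.congr_deriv ?_
    simp only [id, mul_one]
    ring
  rw [intervalIntegral.integral_eq_sub_of_hasDerivAt hd
    (Continuous.intervalIntegrable (by fun_prop) _ _)]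
  simp
  ring

theorem medianMaxEquation_exp (l x : ℝ) :
    MedianMaxEquation (fun x => 1 - Real.exp (-l * x)) (fun x => l * Real.exp (-l * x)) x := by
  have h := intervalIntegral.integral_comp_sub_left (a := (0 : ℝ)) (b := x)
    (fun y => (1 - Real.exp (-l * y)) * (l * Real.exp (-l * y))) x
  simp only [sub_self, sub_zero] at h
  simp only [MedianMaxEquation]
  rw [← h, ← intervalIntegral.integral_const_mul]
  congr 1
  ext y
  have he : Real.exp (-l * x) = Real.exp (-l * y) * Real.exp (-l * (x - y)) := by
    rw [← Real.exp_add]; congr 1; ring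
  rw [he]
  ring

/-- A nonzero analytic solution of the equation does not vanish at the origin. -/
theorem leading_exponent_eq_zero {f : ℝ → ℝ} {m : ℕ} {c : ℝ} (hf : Continuous f)
    (hlead : HasLeadingTerm f m c) (hc : c ≠ 0)
    (heq : ∀ x, 0 < x → MedianMaxEquation (fun x => ∫ t in (0 : ℝ)..x, f t) f x) : m = 0 := by
  have hF : HasLeadingTerm (fun x => ∫ t in (0 : ℝ)..x, f t) (m + 1) (c / (m + 1)) :=
    hlead.primitive hf
  have hFc : Continuous fun x => ∫ t in (0 : ℝ)..x, f t :=
    intervalIntegral.continuous_primitive (fun a b => hf.intervalIntegrable a b) 0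
  unfold MedianMaxEquation at heq
  set F : ℝ → ℝ := fun x => ∫ t in (0 : ℝ)..x, f t
  have hG := hF.mul hlead
  have hH : HasLeadingTerm (fun x => F x ^ 2 * f x) (m + 1 + m) 0 :=
    ((hF.mul hG).congr (v := fun x => F x ^ 2 * f x) (fun x _ => by ring)).of_lt (by omega)
  have hL := hlead.convolution (hG.sub hH) hf (by fun_prop)
  have hR := hlead.mul (hG.primitive (by fun_prop))
  rw [← add_assoc] at hR
  have hval := hL.unique hR heq
  by_contra hm
  have hm1 : (1 : ℝ) ≤ m := by exact_mod_cast Nat.one_le_iff_ne_zero.2 hm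
  have hb : betaNat m (m + 1 + m) ≤ 1 / ((m + 1) * (m + 2)) :=
    (betaNat_anti_right m (by omega)).trans_eq (betaNat_one_right m)
  have hm0 : (m : ℝ) + 1 ≠ 0 := by positivity
  have hbeta : betaNat m (m + 1 + m) = 1 / (2 * (m + 1)) := by
    have h2 : (m : ℝ) + 1 + m + 1 = 2 * (m + 1) := by ring
    push_cast at hval
    rw [h2, sub_zero] at hval
    field_simp at hval ⊢
    linear_combination hval
  rw [hbeta, div_le_div_iff₀ (by positivity) (by positivity)] at hb
  nlinarith

/-- A solution of the equation with `f 0 = l ≠ 0` cannot differ from the exponential density by a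
term of positive order. -/
theorem perturbation_exponent_eq_zero {f : ℝ → ℝ} {n : ℕ} {l d : ℝ} (hf : Continuous f)
    (hlead : HasLeadingTerm f 0 l) (hl : l ≠ 0)
    (hdiff : HasLeadingTerm (fun x => f x - l * Real.exp (-l * x)) n d) (hd : d ≠ 0)
    (heq : ∀ x, 0 < x → MedianMaxEquation (fun x => ∫ t in (0 : ℝ)..x, f t) f x) : n = 0 := by
  by_contra hn
  have hn1 : (1 : ℝ) ≤ n := by exact_mod_cast Nat.one_le_iff_ne_zero.2 hn
  have heq' : ∀ x, MedianMaxEquation (fun x => ∫ t in (0 : ℝ)..x, l * Real.exp (-l * t))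
      (fun x => l * Real.exp (-l * x)) x := fun x => by
    simp only [integral_exp_density]
    exact medianMaxEquation_exp l x
  have hec : Continuous fun x => l * Real.exp (-l * x) := by fun_prop
  have he : HasLeadingTerm (fun x => l * Real.exp (-l * x)) 0 l := by
    have h := hlead.sub (hdiff.of_lt (Nat.pos_of_ne_zero hn))
    simpa using h
  generalize hdef : (fun x => l * Real.exp (-l * x)) = e at *
  have hdefx : ∀ x, l * Real.exp (-l * x) = e x := fun x => congrFun hdef x
  simp only [hdefx] at hdiff heq'
  have hF := hlead.primitive hf
  have hE := he.primitive hec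
  have hD := hdiff.primitive (hf.sub hec)
  have hFc : Continuous fun x => ∫ t in (0 : ℝ)..x, f t :=
    intervalIntegral.continuous_primitive (fun a b => hf.intervalIntegrable a b) 0
  have hEc : Continuous fun x => ∫ t in (0 : ℝ)..x, e t :=
    intervalIntegral.continuous_primitive (fun a b => hec.intervalIntegrable a b) 0
  have hFE : ∀ x : ℝ, ∫ t in (0 : ℝ)..x, (f t - e t)
      = (∫ t in (0 : ℝ)..x, f t) - ∫ t in (0 : ℝ)..x, e t := fun x =>
    intervalIntegral.integral_sub (hf.intervalIntegrable _ _) (hec.intervalIntegrable _ _)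
  simp only [hFE] at hD
  unfold MedianMaxEquation at heq heq'
  set F : ℝ → ℝ := fun x => ∫ t in (0 : ℝ)..x, f t
  set E : ℝ → ℝ := fun x => ∫ t in (0 : ℝ)..x, e t
  have hG := hF.mul hlead
  have hGe := hE.mul he
  have hGd : HasLeadingTerm (fun x => F x * f x - E x * e x) (n + 1)
      (l * d + d / (n + 1) * l) := by
    have h1 := hF.mul hdiff
    have h2 := hD.mul he
    rw [show 0 + 1 + n = n + 1 by ring] at h1
    have h3 := (h1.add h2).congr (v := fun x => F x * f x - E x * e x) fun x _ => by ring
    simpa using h3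
  have hK : HasLeadingTerm (fun x => F x * f x - F x ^ 2 * f x) 1 (l * l) := by
    have hH := ((hF.mul hG).congr (v := fun x => F x ^ 2 * f x) (fun x _ => by ring)).of_lt
      (p := 0 + 1 + 0) (by omega)
    simpa using hG.sub hH
  have hKd : HasLeadingTerm
      (fun x => (F x * f x - F x ^ 2 * f x) - (E x * e x - E x ^ 2 * e x)) (n + 1)
      (l * d + d / (n + 1) * l) := by
    have h1 := (hF.mul hGd).of_lt (p := n + 1) (by omega)
    have h2 := (hD.mul hGe).of_lt (p := n + 1) (by omega)
    have h3 := (hGd.sub (h1.add h2)).congr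
      (v := fun x => (F x * f x - F x ^ 2 * f x) - (E x * e x - E x ^ 2 * e x))
      fun x _ => by ring
    simpa using h3
  have hL1 := hdiff.convolution hK (by fun_prop) (by fun_prop)
  have hL2 := he.convolution hKd (by fun_prop) (by fun_prop)
  rw [show 0 + (n + 1) + 1 = n + 1 + 1 by ring] at hL2
  have hR1 := hdiff.mul (hG.primitive (by fun_prop))
  have hR2 := he.mul (hGd.primitive (by fun_prop))
  rw [show 0 + (n + 1 + 1) = n + (0 + 1 + 0 + 1) by ring] at hR2
  have hval := (hL1.add hL2).unique (hR1.add hR2) fun x hx => by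
    have h1 : ∫ y in (0 : ℝ)..x, (F y * f y - E y * e y)
        = (∫ y in (0 : ℝ)..x, F y * f y) - ∫ y in (0 : ℝ)..x, E y * e y :=
      intervalIntegral.integral_sub (Continuous.intervalIntegrable (by fun_prop) _ _)
        (Continuous.intervalIntegrable (by fun_prop) _ _)
    rw [← intervalIntegral.integral_add (Continuous.intervalIntegrable (by fun_prop) _ _)
      (Continuous.intervalIntegrable (by fun_prop) _ _), h1]
    have h2 : (f x - e x) * (∫ y in (0 : ℝ)..x, F y * f y)
        + e x * ((∫ y in (0 : ℝ)..x, F y * f y) - ∫ y in (0 : ℝ)..x, E y * e y)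
        = f x * (∫ y in (0 : ℝ)..x, F y * f y) - e x * ∫ y in (0 : ℝ)..x, E y * e y := by ring
    rw [h2, ← heq x hx, ← heq' x, ← intervalIntegral.integral_sub
      (Continuous.intervalIntegrable (by fun_prop) _ _)
      (Continuous.intervalIntegrable (by fun_prop) _ _)]
    congr 1
    ext y
    ring
  rw [betaNat_one_right, betaNat_zero_left] at hval
  push_cast at hval
  have h1 : (n : ℝ) + 1 ≠ 0 := by positivity
  have h2 : (n : ℝ) + 2 ≠ 0 := by positivity
  have h3 : (n : ℝ) + 1 + 1 = n + 2 := by ring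
  rw [h3] at hval
  have hz : d * l ^ 2 * (1 / ((n + 1) * (n + 2)) - 1 / 2) = 0 := by
    linear_combination hval
  have hz' : (1 : ℝ) / ((n + 1) * (n + 2)) - 1 / 2 = 0 :=
    (mul_eq_zero.1 hz).resolve_left (by positivity)
  field_simp at hz'
  nlinarith

theorem hasSum_exp_density (l x : ℝ) :
    HasSum (fun k : ℕ => (-1) ^ k * l ^ (k + 1) / k.factorial * x ^ k)
      (l * Real.exp (-l * x)) := by
  have h := (NormedSpace.expSeries_div_hasSum_exp (-l * x)).mul_left l
  rw [← Real.exp_eq_exp_ℝ] at h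
  refine (congrArg (HasSum · _) (funext fun k => ?_)).mp h
  rw [mul_pow, neg_pow]
  ring

/-- An analytic solution of the equation is zero or an exponential density. -/
theorem coeff_eq_of_medianMaxEquation {f : ℝ → ℝ} {c : ℕ → ℝ} (hf : Continuous f)
    (hs : ∀ x, 0 ≤ x → HasSum (fun k => c k * x ^ k) (f x)) (hne : ∃ k, c k ≠ 0)
    (heq : ∀ x, 0 < x → MedianMaxEquation (fun x => ∫ t in (0 : ℝ)..x, f t) f x) :
    c 0 ≠ 0 ∧ ∀ k : ℕ, c k = (-1) ^ k * c 0 ^ (k + 1) / k.factorial := by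
  classical
  have hc0 : c 0 ≠ 0 := by
    have hlead := HasLeadingTerm.of_hasSum (p := Nat.find hne) hs
      fun k hk => not_not.1 (Nat.find_min hne hk)
    have h0 := leading_exponent_eq_zero hf hlead (Nat.find_spec hne) heq
    exact h0 ▸ Nat.find_spec hne
  refine ⟨hc0, ?_⟩
  by_contra! hex
  have hdiff := HasLeadingTerm.of_hasSum (p := Nat.find hex)
    (u := fun x => f x - c 0 * Real.exp (-c 0 * x))
    (c := fun k => c k - (-1) ^ k * c 0 ^ (k + 1) / k.factorial)
    (fun x hx => by
      simpa only [sub_mul] using (hs x hx).sub (hasSum_exp_density (c 0) x))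
    fun k hk => sub_eq_zero.2 (not_not.1 (Nat.find_min hex hk))
  have h0 := perturbation_exponent_eq_zero hf
    (HasLeadingTerm.of_hasSum (p := 0) hs (by simp)) hc0 hdiff
    (sub_ne_zero.2 (Nat.find_spec hex)) heq
  have hspec := Nat.find_spec hex
  rw [h0] at hspec
  simp at hspec

/-- Theorem 2 of the paper, analytic form.  Let `F` be an absolutely continuous
distribution function with `F 0 = 0` whose density `f` admits a Maclaurin series
expansion (one-sided derivatives at `0`) valid for all `x > 0`; let `G x = F x * f x`
and `H x = F x ^ 2 * f x`.  If for all `x > 0`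
`∫₀ˣ f(y) G(x-y) dy - ∫₀ˣ f(y) H(x-y) dy = f(x) ∫₀ˣ G(y) dy`,
then `f⁽ᵏ⁾(0) = (-1)^k f(0)^(k+1)` for every `k`; consequently `f(0) > 0` and
`f x = f 0 * exp (-(f 0) x)` for `x > 0`, i.e. `f` is exponential with rate `λ = f 0`. -/
theorem exponential_of_integral_equation_median_max
    (F f : ℝ → ℝ)
    (hmono : Monotone F)
    (hF0 : F 0 = 0)
    (htop : Tendsto F atTop (nhds 1))
    (hdens : ∀ x ≥ (0 : ℝ), F x = ∫ t in (0 : ℝ)..x, f t)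
    (hsmooth : ContDiffOn ℝ (⊤ : ℕ∞) f (Set.Ici 0))
    (hanal : ∀ x > (0 : ℝ),
      HasSum (fun k : ℕ =>
        iteratedDerivWithin k f (Set.Ici 0) 0 * x ^ k / (Nat.factorial k)) (f x))
    (heq : ∀ x > (0 : ℝ),
      (∫ y in (0 : ℝ)..x, f y * (F (x - y) * f (x - y)))
        - (∫ y in (0 : ℝ)..x, f y * (F (x - y) ^ 2 * f (x - y)))
        = f x * ∫ y in (0 : ℝ)..x, F y * f y) :
    (∀ k : ℕ, iteratedDerivWithin k f (Set.Ici 0) 0 = (-1 : ℝ) ^ k * (f 0) ^ (k + 1))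
    ∧ 0 < f 0 ∧ ∀ x > (0 : ℝ), f x = f 0 * Real.exp (-(f 0) * x) := by
 
  set g : ℝ → ℝ := fun x => f (max x 0) with hg
  have hgf : ∀ x, 0 ≤ x → g x = f x := fun x hx => by simp [hg, max_eq_left hx]
  have hgc : Continuous g :=
    hsmooth.continuousOn.comp_continuous (by fun_prop) fun x => le_max_right x 0
  have hFg : ∀ x, 0 ≤ x → F x = ∫ t in (0 : ℝ)..x, g t := fun x hx => by
    rw [hdens x hx]
    refine intervalIntegral.integral_congr fun t ht => ?_
    rw [Set.uIcc_of_le hx] at ht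
    exact (hgf t ht.1).symm
  have hFc : Continuous fun x => ∫ t in (0 : ℝ)..x, g t :=
    intervalIntegral.continuous_primitive (fun a b => hgc.intervalIntegrable a b) 0
  set c : ℕ → ℝ := fun k => iteratedDerivWithin k f (Set.Ici 0) 0 / k.factorial with hc
  have hc0 : c 0 = f 0 := by simp [hc]
  have hs : ∀ x, 0 ≤ x → HasSum (fun k => c k * x ^ k) (g x) := fun x hx => by
    rw [hgf x hx]
    rcases hx.eq_or_lt with rfl | hx
    · rw [← hc0]
      simpa using hasSum_single (f := fun k => c k * (0 : ℝ) ^ k) 0 fun k hk => by simp [hk]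
    · convert hanal x hx using 1
      ext k
      ring
  have hne : ∃ k, c k ≠ 0 := by
    by_contra! hzero
    have hg0 : ∀ x, 0 ≤ x → g x = 0 := fun x hx =>
      (hs x hx).unique (by simp [hzero])
    have hF : ∀ x, 0 ≤ x → F x = 0 := fun x hx => by
      rw [hFg x hx, intervalIntegral.integral_congr (g := fun _ => (0 : ℝ)) fun t ht => by
        rw [Set.uIcc_of_le hx] at ht
        exact hg0 t ht.1]
      simp
    have h0 : Tendsto F atTop (nhds 0) :=
      tendsto_const_nhds.congr' ((eventually_ge_atTop 0).mono fun x hx => (hF x hx).symm)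
    exact zero_ne_one (tendsto_nhds_unique h0 htop)
  have hgeq : ∀ x, 0 < x → MedianMaxEquation (fun x => ∫ t in (0 : ℝ)..x, g t) g x := by
    intro x hx
    have h := heq x hx
    have hG : ∫ y in (0 : ℝ)..x, f y * (F (x - y) * f (x - y))
        = ∫ y in (0 : ℝ)..x, g y * ((∫ t in (0 : ℝ)..(x - y), g t) * g (x - y)) :=
      intervalIntegral.integral_congr fun y hy => by
        rw [Set.uIcc_of_le hx.le] at hy
        have hxy : 0 ≤ x - y := sub_nonneg.2 hy.2
        simp only [hgf y hy.1, hgf _ hxy, hFg _ hxy]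
    have hH : ∫ y in (0 : ℝ)..x, f y * (F (x - y) ^ 2 * f (x - y))
        = ∫ y in (0 : ℝ)..x, g y * ((∫ t in (0 : ℝ)..(x - y), g t) ^ 2 * g (x - y)) :=
      intervalIntegral.integral_congr fun y hy => by
        rw [Set.uIcc_of_le hx.le] at hy
        have hxy : 0 ≤ x - y := sub_nonneg.2 hy.2
        simp only [hgf y hy.1, hgf _ hxy, hFg _ hxy]
    have hR : ∫ y in (0 : ℝ)..x, F y * f y
        = ∫ y in (0 : ℝ)..x, (∫ t in (0 : ℝ)..y, g t) * g y :=
      intervalIntegral.integral_congr fun y hy => by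
        rw [Set.uIcc_of_le hx.le] at hy
        simp only [hgf y hy.1, hFg y hy.1]
    have hFs : Continuous fun y => ∫ t in (0 : ℝ)..(x - y), g t :=
      hFc.comp (continuous_const.sub continuous_id)
    rw [hG, hH, hR, ← hgf x hx.le, ← intervalIntegral.integral_sub
      (Continuous.intervalIntegrable (by fun_prop) _ _)
      (Continuous.intervalIntegrable (by fun_prop) _ _)] at h
    simpa only [MedianMaxEquation, mul_sub] using h
  obtain ⟨hf0, hcoeff⟩ := coeff_eq_of_medianMaxEquation hgc hs hne hgeq
  rw [hc0] at hf0
  simp only [hc0] at hcoeff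
  refine ⟨fun k => ?_, lt_of_le_of_ne ?_ hf0.symm, fun x hx => ?_⟩
  · have hk := hcoeff k
    simp only [hc] at hk
    exact (div_left_inj' (by positivity)).1 hk
  · have hlead := ((HasLeadingTerm.of_hasSum (p := 0) hs (by simp)).primitive hgc).tendsto
    simp only [hc0, Nat.cast_zero, zero_add, div_one] at hlead
    refine ge_of_tendsto hlead ?_
    filter_upwards [self_mem_nhdsWithin] with x hx
    have hx0 : (0 : ℝ) < x := hx
    rw [← hFg x hx0.le]
    exact div_nonneg (hF0 ▸ hmono hx0.le) (by positivity)
  · rw [← hgf x hx.le]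
    refine (hs x hx.le).unique ?_
    simpa only [hcoeff] using hasSum_exp_density (f 0) x
end
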